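/- arXiv:cs/0701022 — 6 statements merged into one kernel-verified Lean document; each statement's English description precedes it below -/
import Mathlib

section
/- For every extended polynomial f : ℕ → ℕ (i.e., every unary function in the class of extended polynomials), there exists a natural number m such that for all n₁, n₂ ≥ m, if n₁ ≥ n₂ then f(n₁) ≥ f(n₂). In other words, every unary extended polynomial is non-decreasing on all sufficiently large arguments. -/
/-- The class of extended polynomials: the smallest class of functions `ℕ^k → ℕ`
(over all arities `k`) containing the constants `0` and `1`, all projections,
addition, multiplication and `ifzero`, and closed under composition. -/
inductive ExtPoly : ∀ {k : ℕ}, ((Fin k → ℕ) → ℕ) → Prop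
  | zero {k : ℕ} : ExtPoly (fun _ : Fin k → ℕ => 0)
  | one {k : ℕ} : ExtPoly (fun _ : Fin k → ℕ => 1)
  | proj {k : ℕ} (i : Fin k) : ExtPoly (fun v => v i)
  | add : ExtPoly (fun v : Fin 2 → ℕ => v 0 + v 1)
  | mul : ExtPoly (fun v : Fin 2 → ℕ => v 0 * v 1)
  | ifzero : ExtPoly (fun v : Fin 3 → ℕ => if v 0 = 0 then v 1 else v 2)
  | comp {k m : ℕ} {f : (Fin k → ℕ) → ℕ} {g : Fin k → (Fin m → ℕ) → ℕ} :
      ExtPoly f → (∀ i, ExtPoly (g i)) → ExtPoly (fun v => f (fun i => g i v))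

/-- Substituting eventually non-decreasing sequences for the arguments of an extended
polynomial yields an eventually non-decreasing sequence. -/
theorem ExtPoly.exists_monotoneOn_Ici {k : ℕ} {F : (Fin k → ℕ) → ℕ} (hF : ExtPoly F)
    (g : Fin k → ℕ → ℕ) (hg : ∀ i, ∃ m, MonotoneOn (g i) (Set.Ici m)) :
    ∃ m, MonotoneOn (fun n => F (fun i => g i n)) (Set.Ici m) := by
  induction hF with
  | zero => exact ⟨0, monotoneOn_const⟩
  | one => exact ⟨0, monotoneOn_const⟩
  | proj i => exact hg i
  | add =>
    obtain ⟨a, ha⟩ := hg 0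
    obtain ⟨b, hb⟩ := hg 1
    exact ⟨max a b, (ha.mono (Set.Ici_subset_Ici.2 (le_max_left a b))).add
      (hb.mono (Set.Ici_subset_Ici.2 (le_max_right a b)))⟩
  | mul =>
    obtain ⟨a, ha⟩ := hg 0
    obtain ⟨b, hb⟩ := hg 1
    refine ⟨max a b, fun x hx y hy hxy => ?_⟩
    simp only [Set.mem_Ici, max_le_iff] at hx hy
    exact Nat.mul_le_mul (ha hx.1 hy.1 hxy) (hb hx.2 hy.2 hxy)
  | ifzero =>
    obtain ⟨a, ha⟩ := hg 0
    obtain ⟨b, hb⟩ := hg 1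
    obtain ⟨c, hc⟩ := hg 2
    by_cases h : ∀ n, a ≤ n → g 0 n = 0
    · refine ⟨max a b, fun x hx y hy hxy => ?_⟩
      simp only [Set.mem_Ici, max_le_iff] at hx hy
      simpa [h x hx.1, h y hy.1] using hb hx.2 hy.2 hxy
    · push Not at h
      obtain ⟨d, had, hd⟩ := h
      have hpos : ∀ n, d ≤ n → g 0 n ≠ 0 := fun n hn h0 =>
        hd (Nat.le_zero.1 (h0 ▸ ha had (had.trans hn) hn))
      refine ⟨max d c, fun x hx y hy hxy => ?_⟩
      simp only [Set.mem_Ici, max_le_iff] at hx hy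
      simpa [hpos x hx.1, hpos y hy.1] using hc hx.2 hy.2 hxy
  | comp _ _ ihf ihg => exact ihf _ fun i => ihg i g hg

/-- Every unary extended polynomial is non-decreasing on all sufficiently large
arguments. -/
theorem extPoly_eventually_monotone (f : ℕ → ℕ)
    (hf : ExtPoly (fun v : Fin 1 → ℕ => f (v 0))) :
    ∃ m : ℕ, ∀ n₁ n₂ : ℕ, m ≤ n₁ → m ≤ n₂ → n₂ ≤ n₁ → f n₂ ≤ f n₁ := by
  obtain ⟨m, hm⟩ := hf.exists_monotoneOn_Ici (fun _ n => n) fun _ => ⟨0, monotoneOn_id⟩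
  exact ⟨m, fun n₁ n₂ h₁ h₂ h => hm h₂ h₁ h⟩
end

section
/- For every l ≥ 2, the function g : ℕ → ℕ defined by g(n) = n mod l is not an extended polynomial. -/
/-- A function on `ℕ` that is monotone from some point on. -/
def EventuallyMonotone (h : ℕ → ℕ) : Prop :=
  ∃ N, MonotoneOn h (Set.Ici N)

/-- Substituting eventually monotone functions for the arguments of an extended polynomial
gives an eventually monotone function. -/
theorem ExtPoly.eventuallyMonotone {k : ℕ} {f : (Fin k → ℕ) → ℕ} (hf : ExtPoly f) :
    ∀ w : Fin k → ℕ → ℕ, (∀ i, EventuallyMonotone (w i)) →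
      EventuallyMonotone (fun n => f (fun i => w i n)) := by
  induction hf with
  | zero => exact fun _ _ => ⟨0, monotoneOn_const⟩
  | one => exact fun _ _ => ⟨0, monotoneOn_const⟩
  | proj i => exact fun _ hw => hw i
  | add =>
    intro w hw
    obtain ⟨N, hN⟩ := hw 0
    obtain ⟨M, hM⟩ := hw 1
    refine ⟨max N M, fun a ha b hb hab => ?_⟩
    rw [Set.mem_Ici, max_le_iff] at ha hb
    exact add_le_add (hN ha.1 hb.1 hab) (hM ha.2 hb.2 hab)
  | mul =>
    intro w hw
    obtain ⟨N, hN⟩ := hw 0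
    obtain ⟨M, hM⟩ := hw 1
    refine ⟨max N M, fun a ha b hb hab => ?_⟩
    rw [Set.mem_Ici, max_le_iff] at ha hb
    exact Nat.mul_le_mul (hN ha.1 hb.1 hab) (hM ha.2 hb.2 hab)
  | ifzero =>
    intro w hw
    obtain ⟨N, hN⟩ := hw 0
    by_cases h : ∃ n, N ≤ n ∧ w 0 n ≠ 0
    · obtain ⟨n, hn, hpos⟩ := h
      obtain ⟨M, hM⟩ := hw 2
      have ne_zero : ∀ a, n ≤ a → w 0 a ≠ 0 := fun a ha h0 =>
        hpos (Nat.le_zero.mp (h0 ▸ hN hn (hn.trans ha) ha))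
      refine ⟨max n M, fun a ha b hb hab => ?_⟩
      rw [Set.mem_Ici, max_le_iff] at ha hb
      simpa [ne_zero a ha.1, ne_zero b hb.1] using hM ha.2 hb.2 hab
    · push Not at h
      obtain ⟨M, hM⟩ := hw 1
      refine ⟨max N M, fun a ha b hb hab => ?_⟩
      rw [Set.mem_Ici, max_le_iff] at ha hb
      simpa [h a ha.1, h b hb.1] using hM ha.2 hb.2 hab
  | comp _ _ ihf ihg => exact fun w hw => ihf _ fun i => ihg i w hw

/-- For every `l ≥ 2`, the function `n ↦ n % l` is not an extended polynomial. -/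
theorem mod_not_extPoly (l : ℕ) (hl : 2 ≤ l) :
    ¬ ExtPoly (fun v : Fin 1 → ℕ => v 0 % l) := by
  intro h
  obtain ⟨N, hN⟩ := h.eventuallyMonotone (fun _ n => n) fun _ => ⟨0, monotone_id.monotoneOn _⟩
  have hle : N ≤ l * N := Nat.le_mul_of_pos_left N (by omega)
  have key : (l * N + 1) % l ≤ (l * N + l) % l :=
    hN (Set.mem_Ici.mpr (by omega)) (Set.mem_Ici.mpr (by omega)) (by omega)
  rw [Nat.mul_add_mod, Nat.mod_eq_of_lt (by omega), Nat.mul_add_mod, Nat.mod_self] at key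
  omega
end

section
/- For every l ≥ 2, the function n ↦ n mod l belongs to the class 𝒢 but is not an extended polynomial; consequently, the class of extended polynomials is a proper subclass of 𝒢. -/
/-- For `l ≥ 2`, `f₁ˡ(m, n₁, …, n_l) = n_{(m % l) + 1}`, and for `l ≥ 1`,
`f₂ˡ(m, n₁, n₂) = if m ≤ l then n₁ else n₂`.  The class `𝒢` is the smallest
class of functions `ℕ^k → ℕ` containing the extended polynomials, the functions
`f₁ˡ` (`l ≥ 2`) and `f₂ˡ` (`l ≥ 1`), and closed under composition. -/
inductive GClass : ∀ {k : ℕ}, ((Fin k → ℕ) → ℕ) → Prop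
  | ext {k : ℕ} {f : (Fin k → ℕ) → ℕ} : ExtPoly f → GClass f
  | f1 {l : ℕ} (hl : 2 ≤ l) :
      GClass (fun v : Fin (l + 1) → ℕ =>
        v ⟨v 0 % l + 1, Nat.succ_lt_succ (Nat.mod_lt _ (by omega))⟩)
  | f2 {l : ℕ} (hl : 1 ≤ l) :
      GClass (fun v : Fin 3 → ℕ => if v 0 ≤ l then v 1 else v 2)
  | comp {k m : ℕ} {f : (Fin k → ℕ) → ℕ} {g : Fin k → (Fin m → ℕ) → ℕ} :
      GClass f → (∀ i, GClass (g i)) → GClass (fun v => f (fun i => g i v))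

/-- A function `ℕ → ℕ` that agrees with a polynomial over `ℕ` at all large arguments. -/
def EventuallyPolynomial (h : ℕ → ℕ) : Prop :=
  ∃ p : Polynomial ℕ, ∀ᶠ n in Filter.atTop, h n = p.eval n

theorem Polynomial.eval_nat_ne_zero {p : Polynomial ℕ} (hp : p ≠ 0) {n : ℕ} (hn : n ≠ 0) :
    p.eval n ≠ 0 := by
  intro h
  rw [Polynomial.eval_eq_sum, Polynomial.sum, Finset.sum_eq_zero_iff] at h
  have h' := h _ (Polynomial.natDegree_mem_support_of_nonzero hp)
  simp [hp, hn] at h'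

theorem ExtPoly.eventuallyPolynomial_comp {k : ℕ} {f : (Fin k → ℕ) → ℕ} (hf : ExtPoly f) :
    ∀ h : Fin k → ℕ → ℕ, (∀ i, EventuallyPolynomial (h i)) →
      EventuallyPolynomial (fun n => f (fun i => h i n)) := by
  induction hf with
  | zero => exact fun _ _ => ⟨0, by simp⟩
  | one => exact fun _ _ => ⟨1, by simp⟩
  | proj i => exact fun _ hh => hh i
  | add =>
    intro h hh
    obtain ⟨p, hp⟩ := hh 0
    obtain ⟨q, hq⟩ := hh 1
    refine ⟨p + q, ?_⟩
    filter_upwards [hp, hq] with n hpn hqn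
    simp [hpn, hqn]
  | mul =>
    intro h hh
    obtain ⟨p, hp⟩ := hh 0
    obtain ⟨q, hq⟩ := hh 1
    refine ⟨p * q, ?_⟩
    filter_upwards [hp, hq] with n hpn hqn
    simp [hpn, hqn]
  | ifzero =>
    intro h hh
    obtain ⟨p, hp⟩ := hh 0
    by_cases hp0 : p = 0
    · obtain ⟨q, hq⟩ := hh 1
      refine ⟨q, ?_⟩
      filter_upwards [hp, hq] with n hpn hqn
      simp [hpn, hqn, hp0]
    · obtain ⟨q, hq⟩ := hh 2
      refine ⟨q, ?_⟩
      filter_upwards [hp, hq, Filter.eventually_ne_atTop 0] with n hpn hqn hn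
      simp [hpn, hqn, Polynomial.eval_nat_ne_zero hp0 hn]
  | comp _ _ ihf ihg =>
    intro h hh
    exact ihf _ fun i => ihg i h hh

theorem not_eventuallyPolynomial_mod {l : ℕ} (hl : 2 ≤ l) :
    ¬ EventuallyPolynomial (fun n => n % l) := by
  rintro ⟨p, hp⟩
  obtain ⟨N, hN⟩ := Filter.eventually_atTop.1 hp
  have hle : N + 1 ≤ (N + 1) * l := Nat.le_mul_of_pos_right _ (by omega)
  have h0 := hN ((N + 1) * l) (by omega)
  have h1 := hN ((N + 1) * l + 1) (by omega)
  by_cases hp0 : p = 0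
  · simp [hp0, Nat.add_mod, Nat.mod_eq_of_lt (show 1 < l by omega)] at h1
  · exact Polynomial.eval_nat_ne_zero hp0 (n := (N + 1) * l) (by omega) (by simpa using h0.symm)

theorem not_extPoly_mod {l : ℕ} (hl : 2 ≤ l) : ¬ ExtPoly (fun v : Fin 1 → ℕ => v 0 % l) :=
  fun hf => not_eventuallyPolynomial_mod hl
    (hf.eventuallyPolynomial_comp (fun _ n => n) fun _ => ⟨Polynomial.X, by simp⟩)

theorem ExtPoly.const {k : ℕ} (c : ℕ) : ExtPoly (fun _ : Fin k → ℕ => c) := by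
  induction c with
  | zero => exact ExtPoly.zero
  | succ c ih =>
    exact ExtPoly.comp (g := ![fun _ => c, fun _ => 1]) ExtPoly.add
      (Fin.forall_fin_two.2 ⟨ih, ExtPoly.one⟩)

theorem GClass.mod {l : ℕ} (hl : 2 ≤ l) : GClass (fun v : Fin 1 → ℕ => v 0 % l) :=
  GClass.comp
    (g := Fin.cons (fun v : Fin 1 → ℕ => v 0) fun (i : Fin l) (_ : Fin 1 → ℕ) => (i : ℕ))
    (GClass.f1 hl)
    (Fin.cases (GClass.ext (ExtPoly.proj 0)) fun i => GClass.ext (ExtPoly.const (i : ℕ)))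


/-- For every `l ≥ 2`, `n ↦ n % l` is in `𝒢` but is not an extended polynomial;
consequently the extended polynomials form a proper subclass of `𝒢`. -/
theorem extPoly_proper_subclass_of_GClass :
    (∀ l : ℕ, 2 ≤ l →
      GClass (fun v : Fin 1 → ℕ => v 0 % l) ∧
      ¬ ExtPoly (fun v : Fin 1 → ℕ => v 0 % l)) ∧
    (∀ (k : ℕ) (f : (Fin k → ℕ) → ℕ), ExtPoly f → GClass f) ∧
    (∃ (k : ℕ) (f : (Fin k → ℕ) → ℕ), GClass f ∧ ¬ ExtPoly f) := by
  exact ⟨fun _ hl => ⟨GClass.mod hl, not_extPoly_mod hl⟩, fun _ _ => GClass.ext,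
    1, _, GClass.mod le_rfl, not_extPoly_mod le_rfl⟩
end

section
/- For every natural number s, the ternary function h(m, n₁, n₂) = if m = s then n₁ else n₂ belongs to the class 𝒢. -/
/-- The threshold conditional belongs to `𝒢` for every threshold, including `0`. -/
theorem GClass.le_cond (l : ℕ) :
    GClass (fun v : Fin 3 → ℕ => if v 0 ≤ l then v 1 else v 2) := by
  rcases Nat.eq_zero_or_pos l with rfl | hl
  · simpa only [Nat.le_zero] using GClass.ext ExtPoly.ifzero
  · exact GClass.f2 hl

theorem GClass.proj {k : ℕ} (i : Fin k) : GClass (fun v : Fin k → ℕ => v i) :=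
  GClass.ext (ExtPoly.proj i)

/-- Composition of a ternary function of `𝒢` with three functions of `𝒢`. -/
theorem GClass.comp₃ {m : ℕ} {f : (Fin 3 → ℕ) → ℕ} {a b c : (Fin m → ℕ) → ℕ}
    (hf : GClass f) (ha : GClass a) (hb : GClass b) (hc : GClass c) :
    GClass (fun v => f ![a v, b v, c v]) := by
  have h : GClass (fun v => f (fun i => (![a, b, c] : Fin 3 → (Fin m → ℕ) → ℕ) i v)) :=
    GClass.comp hf (by intro i; fin_cases i <;> assumption)
  convert h using 3 with v
  funext i
  fin_cases i <;> rfl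

/-- For every `s`, the function `(m, n₁, n₂) ↦ if m = s then n₁ else n₂`
belongs to `𝒢`. -/
theorem eq_const_cond_mem_GClass (s : ℕ) :
    GClass (fun v : Fin 3 → ℕ => if v 0 = s then v 1 else v 2) := by
  cases s with
  | zero => exact GClass.ext ExtPoly.ifzero
  | succ s =>
    have h := (GClass.le_cond (s + 1)).comp₃ (GClass.proj 0)
      ((GClass.le_cond s).comp₃ (GClass.proj 0) (GClass.proj 2) (GClass.proj 1))
      (GClass.proj (k := 3) 2)
    convert h using 2 with v
    change _ = if v 0 ≤ s + 1 then if v 0 ≤ s then v 2 else v 1 else v 2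
    grind
end

section
/- For every t ≥ 1 and every natural number s, the ternary function h(m, n₁, n₂) = if m ≡ s (mod t) then n₁ else n₂ belongs to the class 𝒢. -/
/-- For every `t ≥ 1` and every `s`, the function
`(m, n₁, n₂) ↦ if m ≡ s [MOD t] then n₁ else n₂` belongs to `𝒢`. -/
theorem modEq_cond_mem_GClass (t : ℕ) (ht : 1 ≤ t) (s : ℕ) :
    GClass (fun v : Fin 3 → ℕ => if v 0 % t = s % t then v 1 else v 2) := by
  rcases Nat.lt_or_ge 1 t with h | h
  · have key := GClass.comp (GClass.f1 h)
      (g := fun i : Fin (t + 1) => fun v : Fin 3 → ℕ =>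
        v (if i.val = 0 then 0 else if i.val = s % t + 1 then 1 else 2))
      (fun i => GClass.ext (ExtPoly.proj _))
    convert key using 2 with v
    simp only [Fin.val_zero, if_true, Nat.add_eq_zero_iff, one_ne_zero, and_false, if_false,
      Nat.add_right_cancel_iff]
    split_ifs <;> rfl
  · obtain rfl : t = 1 := le_antisymm h ht
    simpa only [Nat.mod_one, if_true] using GClass.ext (ExtPoly.proj (1 : Fin 3))
end

section
/- Let A ⊆ ℕ be eventually periodic, i.e., there exist N ∈ ℕ and t ≥ 1 such that for all m ≥ N, m ∈ A if and only if m + t ∈ A. Then the ternary function f(m, n₁, n₂) = if m ∈ A then n₁ else n₂ belongs to the class 𝒢. -/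
theorem GClass.ite_le {k : ℕ} (l : ℕ) {a b c : (Fin k → ℕ) → ℕ}
    (ha : GClass a) (hb : GClass b) (hc : GClass c) :
    GClass (fun v => if a v ≤ l then b v else c v) := by
  have hg : ∀ i, GClass ((![a, b, c] : Fin 3 → (Fin k → ℕ) → ℕ) i) := by
    intro i
    fin_cases i <;> assumption
  rcases Nat.eq_zero_or_pos l with rfl | hl
  · simpa using GClass.comp (GClass.ext ExtPoly.ifzero) hg
  · simpa using GClass.comp (GClass.f2 hl) hg

/-- A conditional on membership in `A` belongs to `𝒢` once it agrees with a member of `𝒢`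
for all large values of the tested argument. -/
theorem GClass.mem_cond_of_eventually_eq (A : Set ℕ) [DecidablePred (· ∈ A)] (n : ℕ)
    {h : (Fin 3 → ℕ) → ℕ} (hG : GClass h)
    (heq : ∀ v, n ≤ v 0 → h v = if v 0 ∈ A then v 1 else v 2) :
    GClass (fun v : Fin 3 → ℕ => if v 0 ∈ A then v 1 else v 2) := by
  induction n generalizing h with
  | zero =>
    rw [← funext fun v => heq v (Nat.zero_le _)]
    exact hG
  | succ n ih =>
    refine ih (GClass.ite_le n (GClass.proj 0) (GClass.proj (if n ∈ A then 1 else 2)) hG) ?_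
    intro v hv
    rcases hv.eq_or_lt with hn | hlt
    · rw [if_pos hn.ge, hn]
      split_ifs <;> rfl
    · rw [if_neg (by omega), heq v hlt]

theorem mem_iff_add_mul_mem {A : Set ℕ} {N t : ℕ}
    (hA : ∀ m, N ≤ m → (m ∈ A ↔ m + t ∈ A)) (k : ℕ) {m : ℕ} (hm : N ≤ m) :
    m ∈ A ↔ m + k * t ∈ A := by
  induction k with
  | zero => simp
  | succ k ih =>
    rw [ih, hA _ (by omega), Nat.succ_mul, Nat.add_assoc]

/-- If `A ⊆ ℕ` is eventually periodic (there are `N` and `t ≥ 1` with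
`m ∈ A ↔ m + t ∈ A` for all `m ≥ N`), then the function
`(m, n₁, n₂) ↦ if m ∈ A then n₁ else n₂` belongs to `𝒢`. -/
theorem eventually_periodic_cond_mem_GClass (A : Set ℕ) [DecidablePred (· ∈ A)]
    (hA : ∃ (N t : ℕ), 1 ≤ t ∧ ∀ m : ℕ, N ≤ m → (m ∈ A ↔ m + t ∈ A)) :
    GClass (fun v : Fin 3 → ℕ => if v 0 ∈ A then v 1 else v 2) := by
  obtain ⟨N, t, ht, hA⟩ := hA
  -- `f₁ˡ` needs `l ≥ 2`, so double the period.
  obtain ⟨l, hl, hper⟩ : ∃ l, 2 ≤ l ∧ ∀ m, N ≤ m → (m ∈ A ↔ m + l ∈ A) :=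
    ⟨2 * t, by omega, fun m hm => mem_iff_add_mul_mem hA 2 hm⟩
  let s : Fin (l + 1) → Fin 3 := Fin.cases 0 fun i => if N * l + i ∈ A then 1 else 2
  refine GClass.mem_cond_of_eventually_eq A N
    (GClass.comp (GClass.f1 hl) fun i => GClass.proj (s i)) fun v hv => ?_
  have hmem : N * l + v 0 % l ∈ A ↔ v 0 ∈ A := by
    have hN : N ≤ N * l + v 0 % l :=
      (Nat.le_mul_of_pos_right N (by omega)).trans (Nat.le_add_right _ _)
    rw [mem_iff_add_mul_mem hper (v 0 / l) hN, mem_iff_add_mul_mem hper N hv,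
      Nat.add_assoc, Nat.mod_add_div', Nat.add_comm]
  have hs : s ⟨v 0 % l + 1, Nat.succ_lt_succ (Nat.mod_lt _ (by omega))⟩ =
      if v 0 ∈ A then 1 else 2 := by
    change (if N * l + v 0 % l ∈ A then (1 : Fin 3) else 2) = _
    simp only [hmem]
  change v (s ⟨v 0 % l + 1, _⟩) = _
  rw [hs]
  split_ifs <;> rfl
end
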